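/- Let U be unitary, A self-adjoint, U ∈ C^1(A), and suppose D := s-lim_{N→∞}(1/N)Σ_{n=0}^{N−1}U^n([A,U]U^{-1})U^{-n} exists and, for each φ ∈ dom(A), Σ_{N≥1} ‖(D_N − D)φ‖² < ∞ where D_N is the N-th Birkhoff average. Then for each φ ∈ dom(A) with φ = η(D)φ for some η ∈ C_c^∞(ℝ∖{0}) and assuming D^{-1}η(D) dom(A) ⊂ dom(A), one has Σ_{N≥1} |⟨φ, U^N φ⟩|² < ∞; consequently such φ lies in the absolutely continuous subspace of U. -/

import Mathlib

open scoped ComplexInnerProductSpace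
open Filter MeasureTheory

/-- A vector `φ` belongs to the absolutely continuous subspace `𝓗_ac(U)` of a unitary operator
`U`: its spectral measure (the measure on the circle whose Fourier coefficients are the
correlations `⟪φ, U^n φ⟫`, `n ∈ ℤ`) is absolutely continuous, i.e. it has an integrable
density `f ≥ 0` with respect to Lebesgue measure on `[0, 2π)`. -/
def MemAbsContSubspace {𝓗 : Type*} [NormedAddCommGroup 𝓗] [InnerProductSpace ℂ 𝓗]
    [CompleteSpace 𝓗] (U : 𝓗 →L[ℂ] 𝓗) (hU : U ∈ unitary (𝓗 →L[ℂ] 𝓗)) (φ : 𝓗) : Prop :=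
  ∃ f : ℝ → ℝ, (∀ θ, 0 ≤ f θ) ∧
    IntegrableOn f (Set.Ioc 0 (2 * Real.pi)) volume ∧
    ∀ n : ℤ, ⟪φ, ((((⟨U, hU⟩ : unitary (𝓗 →L[ℂ] 𝓗)) ^ n :
        unitary (𝓗 →L[ℂ] 𝓗)) : 𝓗 →L[ℂ] 𝓗)) φ⟫ =
      ∫ θ in Set.Ioc (0 : ℝ) (2 * Real.pi), Complex.exp (Complex.I * n * θ) * (f θ : ℂ)


theorem form_polarize {𝓗 : Type*} [NormedAddCommGroup 𝓗] [InnerProductSpace ℂ 𝓗]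
    (U : 𝓗 →L[ℂ] 𝓗) (A : 𝓗 →ₗ.[ℂ] 𝓗) (B : 𝓗 →L[ℂ] 𝓗)
    (hB : ∀ φ : A.domain, ⟪A φ, U (φ : 𝓗)⟫ - ⟪(φ : 𝓗), U (A φ)⟫ = ⟪(φ : 𝓗), B (φ : 𝓗)⟫)
    (x y : A.domain) :
    ⟪A x, U (y : 𝓗)⟫ - ⟪(x : 𝓗), U (A y)⟫ = ⟪(x : 𝓗), B (y : 𝓗)⟫ := by
  have h1 := hB x
  have h2 := hB y
  have h3 := hB (x + y)
  have h4 := hB (x + Complex.I • y)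
  simp only [LinearPMap.map_add, LinearPMap.map_smul, map_add, map_smul, inner_add_left,
    inner_add_right, inner_smul_left, inner_smul_right, Complex.conj_I, Submodule.coe_add,
    Submodule.coe_smul] at h3 h4
  have hI := Complex.I_mul_I
  linear_combination (1/2 : ℂ) * (h3 - h1 - h2) - (Complex.I / 2) * (h4 - h1 - h2) +
    (1/2 : ℂ) * (⟪A x, U (y : 𝓗)⟫ - ⟪(x : 𝓗), U (A y)⟫ - ⟪(x : 𝓗), B (y : 𝓗)⟫) * hI -
    (1/2 : ℂ) * (⟪A y, U (x : 𝓗)⟫ - ⟪(y : 𝓗), U (A x)⟫ - ⟪(y : 𝓗), B (x : 𝓗)⟫) * hI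
    - (Complex.I / 2) * (⟪A y, U (y : 𝓗)⟫ - ⟪(y : 𝓗), U (A y)⟫ - ⟪(y : 𝓗), B (y : 𝓗)⟫) * hI

theorem sa_symm {𝓗 : Type*} [NormedAddCommGroup 𝓗] [InnerProductSpace ℂ 𝓗] [CompleteSpace 𝓗]
    (A : 𝓗 →ₗ.[ℂ] 𝓗) (hA : IsSelfAdjoint A) (x y : A.domain) :
    ⟪A x, (y : 𝓗)⟫ = ⟪(x : 𝓗), A y⟫ := by
  have h := LinearPMap.adjoint_isFormalAdjoint hA.dense_domain
  rw [LinearPMap.isSelfAdjoint_def.1 hA] at h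
  exact h x y

theorem sa_mem {𝓗 : Type*} [NormedAddCommGroup 𝓗] [InnerProductSpace ℂ 𝓗] [CompleteSpace 𝓗]
    (A : 𝓗 →ₗ.[ℂ] 𝓗) (hA : IsSelfAdjoint A) (y w : 𝓗)
    (h : ∀ x : A.domain, ⟪w, (x : 𝓗)⟫ = ⟪y, A x⟫) : ∃ hy : y ∈ A.domain, A ⟨y, hy⟩ = w := by
  have hmem : y ∈ A.adjoint.domain := LinearPMap.mem_adjoint_domain_of_exists y ⟨w, h⟩
  have he := LinearPMap.adjoint_apply_eq hA.dense_domain ⟨y, hmem⟩ h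
  have hA' := LinearPMap.isSelfAdjoint_def.1 hA
  have key : ∀ T : 𝓗 →ₗ.[ℂ] 𝓗, T = A → ∀ hm : y ∈ T.domain, T ⟨y, hm⟩ = w →
      ∃ hy : y ∈ A.domain, A ⟨y, hy⟩ = w := by
    rintro T rfl hm h
    exact ⟨hm, h⟩
  exact key _ hA' hmem he

theorem comm_U {𝓗 : Type*} [NormedAddCommGroup 𝓗] [InnerProductSpace ℂ 𝓗] [CompleteSpace 𝓗]
    (U : 𝓗 →L[ℂ] 𝓗) (A : 𝓗 →ₗ.[ℂ] 𝓗) (hA : IsSelfAdjoint A) (B : 𝓗 →L[ℂ] 𝓗)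
    (hB : ∀ φ : A.domain, ⟪A φ, U (φ : 𝓗)⟫ - ⟪(φ : 𝓗), U (A φ)⟫ = ⟪(φ : 𝓗), B (φ : 𝓗)⟫)
    (y : A.domain) : ∃ hy : U y ∈ A.domain, A ⟨U y, hy⟩ = U (A y) + B y := by
  refine sa_mem A hA _ _ fun x => ?_
  have h := form_polarize U A B hB x y
  rw [← inner_conj_symm, ← inner_conj_symm (U (y : 𝓗)), inner_add_right, ← h]
  congr 1
  ring

theorem B_symm {𝓗 : Type*} [NormedAddCommGroup 𝓗] [InnerProductSpace ℂ 𝓗] [CompleteSpace 𝓗]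
    (U : 𝓗 →L[ℂ] 𝓗) (hU : U ∈ unitary (𝓗 →L[ℂ] 𝓗))
    (A : 𝓗 →ₗ.[ℂ] 𝓗) (hA : IsSelfAdjoint A) (B : 𝓗 →L[ℂ] 𝓗)
    (hB : ∀ φ : A.domain, ⟪A φ, U (φ : 𝓗)⟫ - ⟪(φ : 𝓗), U (A φ)⟫ = ⟪(φ : 𝓗), B (φ : 𝓗)⟫)
    (x y : 𝓗) : ⟪B x, U y⟫ = ⟪U x, B y⟫ := by
  have hUU : ∀ a b : 𝓗, ⟪U a, U b⟫ = ⟪a, b⟫ := fun a b =>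
    ContinuousLinearMap.inner_map_map_of_mem_unitary hU a b
  have hd : DenseRange (Subtype.val : A.domain → 𝓗) := hA.dense_domain.denseRange_val
  refine hd.induction_on₂ (p := fun x y => ⟪B x, U y⟫ = ⟪U x, B y⟫) ?_ ?_ x y
  · exact isClosed_eq (by fun_prop) (by fun_prop)
  · intro a b
    obtain ⟨ha, ea⟩ := comm_U U A hA B hB a
    obtain ⟨hb, eb⟩ := comm_U U A hA B hB b
    have h := sa_symm A hA ⟨U a, ha⟩ ⟨U b, hb⟩
    have h' := sa_symm A hA a b
    rw [ea, eb] at h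
    simp only [inner_add_left, inner_add_right, hUU] at h
    linear_combination h - h'

theorem C_sa {𝓗 : Type*} [NormedAddCommGroup 𝓗] [InnerProductSpace ℂ 𝓗] [CompleteSpace 𝓗]
    (U : 𝓗 →L[ℂ] 𝓗) (hU : U ∈ unitary (𝓗 →L[ℂ] 𝓗))
    (A : 𝓗 →ₗ.[ℂ] 𝓗) (hA : IsSelfAdjoint A) (B : 𝓗 →L[ℂ] 𝓗)
    (hB : ∀ φ : A.domain, ⟪A φ, U (φ : 𝓗)⟫ - ⟪(φ : 𝓗), U (A φ)⟫ = ⟪(φ : 𝓗), B (φ : 𝓗)⟫) :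
    IsSelfAdjoint (B * star U) := by
  rw [ContinuousLinearMap.isSelfAdjoint_iff_isSymmetric]
  intro x y
  have h := B_symm U hU A hA B hB (star U x) (star U y)
  have hx : ∀ z, U (star U z) = z := fun z => by
    rw [← mul_apply_eq_comp, Unitary.mul_star_self_of_mem hU]; rfl
  rw [hx, hx] at h
  exact h

theorem sum_sa {𝓗 : Type*} [NormedAddCommGroup 𝓗] [InnerProductSpace ℂ 𝓗] [CompleteSpace 𝓗]
    (U C : 𝓗 →L[ℂ] 𝓗) (hC : IsSelfAdjoint C) (N : ℕ) :
    IsSelfAdjoint (∑ n ∈ Finset.range N, U ^ n * C * (star U) ^ n) := by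
  refine isSelfAdjoint_sum _ fun n _ => ?_
  rw [← star_pow]
  exact hC.conjugate _

theorem comm_pow {𝓗 : Type*} [NormedAddCommGroup 𝓗] [InnerProductSpace ℂ 𝓗] [CompleteSpace 𝓗]
    (U : 𝓗 →L[ℂ] 𝓗) (hU : U ∈ unitary (𝓗 →L[ℂ] 𝓗))
    (A : 𝓗 →ₗ.[ℂ] 𝓗) (hA : IsSelfAdjoint A) (B : 𝓗 →L[ℂ] 𝓗)
    (hB : ∀ φ : A.domain, ⟪A φ, U (φ : 𝓗)⟫ - ⟪(φ : 𝓗), U (A φ)⟫ = ⟪(φ : 𝓗), B (φ : 𝓗)⟫)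
    (y : A.domain) (N : ℕ) : ∃ hy : (U ^ N) y ∈ A.domain, A ⟨(U ^ N) y, hy⟩ =
      (U ^ N) (A y) + (∑ n ∈ Finset.range N, U ^ n * (B * star U) * (star U) ^ n)
        ((U ^ N) y) := by
  induction N with
  | zero => exact ⟨by simp, by simp⟩
  | succ N ih =>
    obtain ⟨h, e⟩ := ih
    obtain ⟨h', e'⟩ := comm_U U A hA B hB ⟨_, h⟩
    have hUs : star U * U = 1 := Unitary.star_mul_self_of_mem hU
    have hE : (U ^ (N + 1)) (y : 𝓗) = U ((U ^ N) y) := by rw [pow_succ']; rfl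
    have hE2 : (U ^ (N + 1)) (A y) = U ((U ^ N) (A y)) := by rw [pow_succ']; rfl
    simp only [hE, hE2]
    refine ⟨h', ?_⟩
    rw [e', e, map_add, add_assoc]
    congr 1
    have key : (∑ n ∈ Finset.range (N + 1), U ^ n * (B * star U) * (star U) ^ n) * U =
        U * (∑ n ∈ Finset.range N, U ^ n * (B * star U) * (star U) ^ n) + B := by
      rw [Finset.sum_range_succ', add_mul]
      congr 1
      · rw [Finset.sum_mul, Finset.mul_sum]
        refine Finset.sum_congr rfl fun n _ => ?_
        rw [pow_succ' U, pow_succ (star U)]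
        simp only [mul_assoc, hUs, mul_one]
      · simp [mul_assoc, hUs]
    have := congrArg (fun T : 𝓗 →L[ℂ] 𝓗 => T ((U ^ N) (y : 𝓗))) key
    simpa using this.symm

theorem D_cfc {𝓗 : Type*} [NormedAddCommGroup 𝓗] [InnerProductSpace ℂ 𝓗] [CompleteSpace 𝓗]
    (D : 𝓗 →L[ℂ] 𝓗) (hD : IsSelfAdjoint D) (η : ℝ → ℝ) (hc : Continuous η)
    (h0 : (0 : ℝ) ∉ tsupport η) :
    D * cfc (fun x : ℝ => x⁻¹ * η x) D = cfc η D := by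
  have hcont : Continuous (fun x : ℝ => x⁻¹ * η x) := by
    rw [continuous_iff_continuousAt]
    intro x
    by_cases hx : x = 0
    · subst hx
      have : (fun x : ℝ => x⁻¹ * η x) =ᶠ[nhds 0] fun _ => 0 := by
        filter_upwards [notMem_tsupport_iff_eventuallyEq.1 h0] with z hz
        simp [hz]
      exact continuousAt_const.congr this.symm
    · exact (continuousAt_inv₀ hx).mul hc.continuousAt
  have h := cfc_mul (fun x : ℝ => x) (fun x : ℝ => x⁻¹ * η x) D (by fun_prop) hcont.continuousOn
  rw [cfc_id' ℝ D] at h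
  rw [← h]
  congr 1
  funext x
  by_cases hx : x = 0
  · subst hx
    have := image_eq_zero_of_notMem_tsupport h0
    simp [this]
  · field_simp

theorem part1 {𝓗 : Type*} [NormedAddCommGroup 𝓗] [InnerProductSpace ℂ 𝓗] [CompleteSpace 𝓗]
    (U : 𝓗 →L[ℂ] 𝓗) (hU : U ∈ unitary (𝓗 →L[ℂ] 𝓗))
    (A : 𝓗 →ₗ.[ℂ] 𝓗) (hA : IsSelfAdjoint A)
    (B : 𝓗 →L[ℂ] 𝓗)
    (hB : ∀ φ : A.domain, ⟪A φ, U (φ : 𝓗)⟫ - ⟪(φ : 𝓗), U (A φ)⟫ = ⟪(φ : 𝓗), B (φ : 𝓗)⟫)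
    (D : 𝓗 →L[ℂ] 𝓗)
    (hsum : ∀ φ : A.domain, Summable (fun N : ℕ =>
      ‖(((N + 1 : ℂ))⁻¹ • ∑ n ∈ Finset.range (N + 1),
          U ^ n * (B * star U) * (star U) ^ n) (φ : 𝓗) - D (φ : 𝓗)‖ ^ 2))
    (φ ψ : A.domain) (h : (φ : 𝓗) = D ψ) :
    Summable (fun N : ℕ => ‖⟪(φ : 𝓗), (U ^ (N + 1)) φ⟫‖ ^ 2) := by
  have hnorm : ∀ (N : ℕ) (x : 𝓗), ‖(U ^ N) x‖ = ‖x‖ := fun N x =>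
    ContinuousLinearMap.norm_map_of_mem_unitary (pow_mem hU N) x
  set c : ℝ := ‖A ψ‖ * ‖(φ : 𝓗)‖ + ‖(ψ : 𝓗)‖ * ‖A φ‖ with hc
  set S : ℕ → 𝓗 →L[ℂ] 𝓗 := fun N =>
    ∑ n ∈ Finset.range N, U ^ n * (B * star U) * (star U) ^ n with hS
  set r : ℕ → ℝ := fun N => ‖(((N + 1 : ℂ))⁻¹ • S (N + 1)) (ψ : 𝓗) - D (ψ : 𝓗)‖ with hr
  have hbound : ∀ N : ℕ, ‖⟪(φ : 𝓗), (U ^ (N + 1)) φ⟫‖ ≤ r N * ‖(φ : 𝓗)‖ + c * ((N : ℝ) + 1)⁻¹ := by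
    intro N
    obtain ⟨hm, e⟩ := comm_pow U hU A hA B hB φ (N + 1)
    have hsa := (ContinuousLinearMap.isSelfAdjoint_iff_isSymmetric.1
      (sum_sa U _ (C_sa U hU A hA B hB) (N + 1))) ψ ((U ^ (N + 1)) φ)
    have hs := sa_symm A hA ψ ⟨_, hm⟩
    rw [e, inner_add_right] at hs
    change ⟪S (N + 1) ψ, _⟫ = ⟪(ψ : 𝓗), S (N + 1) _⟫ at hsa
    have hSn : ⟪S (N + 1) ψ, (U ^ (N + 1)) φ⟫ =
        ⟪A ψ, (U ^ (N + 1)) φ⟫ - ⟪(ψ : 𝓗), (U ^ (N + 1)) (A φ)⟫ := by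
      rw [hsa]
      exact eq_sub_of_add_eq' hs.symm
    have hsplit : ⟪(φ : 𝓗), (U ^ (N + 1)) φ⟫ =
        -⟪(((N + 1 : ℂ))⁻¹ • S (N + 1)) (ψ : 𝓗) - D (ψ : 𝓗), (U ^ (N + 1)) φ⟫ +
        ((N : ℂ) + 1)⁻¹ *
          (⟪A ψ, (U ^ (N + 1)) φ⟫ - ⟪(ψ : 𝓗), (U ^ (N + 1)) (A φ)⟫) := by
      rw [← hSn, inner_sub_left, ← h, smul_apply, inner_smul_left]
      have : (starRingEnd ℂ) ((N : ℂ) + 1)⁻¹ = ((N : ℂ) + 1)⁻¹ := by simp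
      rw [this]; ring
    rw [hsplit]
    refine (norm_add_le _ _).trans (add_le_add ?_ ?_)
    · rw [norm_neg]
      refine (norm_inner_le_norm _ _).trans ?_
      rw [hnorm]
    · rw [norm_mul, mul_comm]
      have h1 : ‖((N : ℂ) + 1)⁻¹‖ = ((N : ℝ) + 1)⁻¹ := by
        rw [norm_inv]; congr 1; exact_mod_cast Complex.norm_natCast (N + 1)
      rw [h1]
      gcongr
      refine (norm_sub_le _ _).trans (add_le_add ?_ ?_)
      · refine (norm_inner_le_norm _ _).trans ?_
        rw [hnorm]
      · refine (norm_inner_le_norm _ _).trans ?_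
        rw [hnorm]
  have hs1 : Summable fun N : ℕ => r N ^ 2 := hsum ψ
  have hs2 : Summable fun N : ℕ => (((N : ℝ) + 1)⁻¹) ^ 2 := by
    have := (summable_nat_add_iff 1).2 (Real.summable_nat_pow_inv (p := 2) |>.2 (by norm_num))
    refine this.congr fun N => ?_
    push_cast
    rw [inv_pow]
  refine Summable.of_nonneg_of_le (fun _ => by positivity) (fun N => ?_)
    ((hs1.mul_left (2 * ‖(φ : 𝓗)‖ ^ 2)).add (hs2.mul_left (2 * c ^ 2)))
  have h1 := pow_le_pow_left₀ (norm_nonneg _) (hbound N) 2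
  refine h1.trans ?_
  nlinarith [sq_nonneg (r N * ‖(φ : 𝓗)‖ - c * ((N : ℝ) + 1)⁻¹)]

theorem sum_Icc_symm {E : Type*} [AddCommMonoid E] (x : ℤ → E) (N : ℕ) :
    ∑ n ∈ Finset.Icc (-(N : ℤ)) N, x n =
      ∑ j ∈ Finset.range N, x ((j : ℤ) - N) + ∑ k ∈ Finset.range N, x ((N : ℤ) - k) + x 0 := by
  induction N with
  | zero => simp
  | succ N ih =>
    have h : Finset.Icc (-((N + 1 : ℕ) : ℤ)) ((N + 1 : ℕ) : ℤ) =
        insert (-((N : ℤ) + 1)) (insert ((N : ℤ) + 1) (Finset.Icc (-(N : ℤ)) N)) := by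
      ext z
      simp only [Finset.mem_insert, Finset.mem_Icc]
      omega
    rw [h, Finset.sum_insert (by simp only [Finset.mem_insert, Finset.mem_Icc]; omega),
      Finset.sum_insert (by simp only [Finset.mem_Icc]; omega), ih,
      Finset.sum_range_succ' _ N, Finset.sum_range_succ' _ N]
    have e1 : ∀ k : ℕ, ((k + 1 : ℕ) : ℤ) - ((N + 1 : ℕ) : ℤ) = (k : ℤ) - N := by intro k; omega
    have e2 : ∀ k : ℕ, ((N + 1 : ℕ) : ℤ) - ((k + 1 : ℕ) : ℤ) = (N : ℤ) - k := by intro k; omega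
    have e3 : ((0 : ℕ) : ℤ) - ((N + 1 : ℕ) : ℤ) = -((N : ℤ) + 1) := by omega
    have e4 : ((N + 1 : ℕ) : ℤ) - ((0 : ℕ) : ℤ) = (N : ℤ) + 1 := by omega
    simp only [e1, e2, e3, e4]
    abel

theorem fejer_sum {E : Type*} [AddCommMonoid E] (x : ℤ → E) (N : ℕ) :
    ∑ M ∈ Finset.range N, ∑ n ∈ Finset.Icc (-(M : ℤ)) M, x n =
      ∑ j ∈ Finset.range N, ∑ k ∈ Finset.range N, x ((j : ℤ) - k) := by
  induction N with
  | zero => simp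
  | succ N ih =>
    rw [Finset.sum_range_succ, ih, sum_Icc_symm, Finset.sum_range_succ _ N]
    simp only [Finset.sum_range_succ _ N, Finset.sum_add_distrib, sub_self]
    abel

open AddCircle in
theorem fejer_nonneg {𝓗 : Type*} [NormedAddCommGroup 𝓗] [InnerProductSpace ℂ 𝓗]
    (c : ℤ → ℂ) (v : ℕ → 𝓗) (hv : ∀ j k : ℕ, ⟪v j, v k⟫ = c ((j : ℤ) - k))
    {T : ℝ} (N : ℕ) (t : AddCircle T) :
    ∑ j ∈ Finset.range N, ∑ k ∈ Finset.range N,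
      c ((j : ℤ) - k) * fourier ((j : ℤ) - k) t =
      ((‖∑ j ∈ Finset.range N, fourier (-(j : ℤ)) t • v j‖ ^ 2 : ℝ) : ℂ) := by
  have h := inner_self_eq_norm_sq_to_K (𝕜 := ℂ) (∑ j ∈ Finset.range N, fourier (-(j : ℤ)) t • v j)
  push_cast
  refine Eq.trans ?_ h
  rw [sum_inner]
  refine Finset.sum_congr rfl fun j _ => ?_
  rw [inner_sum]
  refine Finset.sum_congr rfl fun k _ => ?_
  rw [inner_smul_left, inner_smul_right, hv, ← fourier_neg, neg_neg, sub_eq_add_neg, fourier_add]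
  ring

open AddCircle in
theorem herglotz_L2 {𝓗 : Type*} [NormedAddCommGroup 𝓗] [InnerProductSpace ℂ 𝓗]
    (c : ℤ → ℂ) (v : ℕ → 𝓗) (hv : ∀ j k : ℕ, ⟪v j, v k⟫ = c ((j : ℤ) - k))
    (hc : Summable fun n : ℤ => ‖c n‖ ^ 2) {T : ℝ} [hT : Fact (0 < T)] :
    ∃ g : Lp ℂ 2 (@haarAddCircle T hT), (∀ n, fourierCoeff g n = c n) ∧
      ∀ᵐ t ∂(@haarAddCircle T hT), g t = (‖g t‖ : ℂ) := by
  have hmem : Memℓp c 2 := by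
    rw [memℓp_gen_iff (by norm_num)]
    simpa using hc
  let g : Lp ℂ 2 (@haarAddCircle T hT) := fourierBasis.repr.symm ⟨c, hmem⟩
  have hg : ∀ n, fourierCoeff g n = c n := by
    intro n
    rw [← fourierBasis_repr]
    simp [g]
  refine ⟨g, hg, ?_⟩
  have hs := hasSum_fourier_series_L2 g
  simp only [hg] at hs
  have ht := (hs.comp (Finset.tendsto_Icc_neg (R := ℤ))).cesaro_smul
  set F : ℕ → C(AddCircle T, ℂ) := fun N => ((N : ℂ)⁻¹) • ∑ j ∈ Finset.range N,
    ∑ k ∈ Finset.range N, c ((j : ℤ) - k) • fourier ((j : ℤ) - k) with hF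
  have ht' : Tendsto (fun N => ContinuousMap.toLp (E := ℂ) 2 (@haarAddCircle T hT) ℂ (F N)) atTop
      (nhds g) := by
    refine ht.congr fun N => ?_
    simp only [Function.comp_apply]
    have h1 := fejer_sum (fun n : ℤ => c n • (fourierLp 2 n : Lp ℂ 2 (@haarAddCircle T hT))) N
    rw [h1, hF]
    simp only [map_smul, map_sum]
    exact inv_natCast_smul_eq ℝ ℂ N _
  obtain ⟨ns, -, hns⟩ := (tendstoInMeasure_of_tendsto_Lp ht').exists_seq_tendsto_ae
  have hco : ∀ᵐ t ∂(@haarAddCircle T hT), ∀ N : ℕ,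
      ContinuousMap.toLp (E := ℂ) 2 (@haarAddCircle T hT) ℂ (F N) t = F N t :=
    ae_all_iff.2 fun N => ContinuousMap.coeFn_toLp (𝕜 := ℂ) _ (F N)
  filter_upwards [hns, hco] with t h1 h2
  have hcl : IsClosed {z : ℂ | z = (‖z‖ : ℂ)} := isClosed_eq (by fun_prop) (by fun_prop)
  refine hcl.mem_of_tendsto h1 (Eventually.of_forall fun i => ?_)
  have hFt : F (ns i) t = (((ns i : ℝ)⁻¹ *
      ‖∑ j ∈ Finset.range (ns i), fourier (-(j : ℤ)) t • v j‖ ^ 2 : ℝ) : ℂ) := by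
    have := fejer_nonneg c v hv (ns i) t
    rw [Complex.ofReal_mul, ← this]
    simp [hF]
  rw [Set.mem_ofPred_eq, h2, hFt, Complex.norm_real, Real.norm_of_nonneg (by positivity)]

open AddCircle in
theorem herglotz_density {𝓗 : Type*} [NormedAddCommGroup 𝓗] [InnerProductSpace ℂ 𝓗]
    (c : ℤ → ℂ) (v : ℕ → 𝓗) (hv : ∀ j k : ℕ, ⟪v j, v k⟫ = c ((j : ℤ) - k))
    (hc : Summable fun n : ℤ => ‖c n‖ ^ 2) :
    ∃ f : ℝ → ℝ, (∀ θ, 0 ≤ f θ) ∧ IntegrableOn f (Set.Ioc 0 (2 * Real.pi)) volume ∧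
      ∀ n : ℤ, c (-n) = ∫ θ in Set.Ioc (0 : ℝ) (2 * Real.pi),
        Complex.exp (Complex.I * n * θ) * (f θ : ℂ) := by
  have hpi : (0 : ℝ) < 2 * Real.pi := by positivity
  have hT : Fact (0 < 2 * Real.pi) := ⟨hpi⟩
  obtain ⟨g, hg, hpos⟩ := herglotz_L2 c v hv hc (T := 2 * Real.pi)
  have hmp := AddCircle.measurePreserving_mk (2 * Real.pi) 0
  rw [zero_add] at hmp
  have hpos' : ∀ᵐ t ∂(volume : Measure (AddCircle (2 * Real.pi))), g t = (‖g t‖ : ℂ) := by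
    rw [volume_eq_smul_haarAddCircle]
    exact Measure.ae_smul_measure hpos _
  have hint : Integrable g (volume : Measure (AddCircle (2 * Real.pi))) := by
    have h2 : Integrable g (@haarAddCircle (2 * Real.pi) hT) :=
      (Lp.memLp g).integrable (by norm_num)
    rw [volume_eq_smul_haarAddCircle]
    exact h2.smul_measure (by finiteness)
  refine ⟨fun θ => (2 * Real.pi)⁻¹ * ‖g (θ : AddCircle (2 * Real.pi))‖, fun θ => by positivity,
    ?_, fun n => ?_⟩
  · exact ((hmp.integrable_comp_of_integrable hint).norm).const_mul _
  · have hae := hmp.quasiMeasurePreserving.ae hpos'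
    rw [← hg (-n), fourierCoeff_eq_intervalIntegral _ _ 0, zero_add,
      intervalIntegral.integral_of_le hpi.le, ← integral_smul]
    refine integral_congr_ae ?_
    filter_upwards [hae] with θ hθ
    rw [hθ, fourier_coe_apply]
    have e : 2 * (Real.pi : ℂ) * Complex.I * ((- -n : ℤ) : ℂ) * (θ : ℂ) / ((2 * Real.pi : ℝ) : ℂ)
        = Complex.I * n * θ := by
      have : (Real.pi : ℂ) ≠ 0 := by exact_mod_cast Real.pi_ne_zero
      push_cast
      field_simp
    rw [e]
    simp only [Complex.real_smul, smul_eq_mul, Complex.norm_real, norm_norm]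
    push_cast
    ring

theorem part2 {𝓗 : Type*} [NormedAddCommGroup 𝓗] [InnerProductSpace ℂ 𝓗] [CompleteSpace 𝓗]
    (U : 𝓗 →L[ℂ] 𝓗) (hU : U ∈ unitary (𝓗 →L[ℂ] 𝓗)) (φ : 𝓗)
    (hs : Summable (fun N : ℕ => ‖⟪φ, (U ^ (N + 1)) φ⟫‖ ^ 2)) : MemAbsContSubspace U hU φ := by
  set V : unitary (𝓗 →L[ℂ] 𝓗) := ⟨U, hU⟩ with hV
  have hVU : ∀ n : ℕ, ((V ^ n : unitary (𝓗 →L[ℂ] 𝓗)) : 𝓗 →L[ℂ] 𝓗) = U ^ n := fun n => rfl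
  let d : ℤ → ℂ := fun n => ⟪φ, ((V ^ n : unitary (𝓗 →L[ℂ] 𝓗)) : 𝓗 →L[ℂ] 𝓗) φ⟫
  have hinn : ∀ m n : ℤ, ⟪((V ^ m : unitary (𝓗 →L[ℂ] 𝓗)) : 𝓗 →L[ℂ] 𝓗) φ,
      ((V ^ n : unitary (𝓗 →L[ℂ] 𝓗)) : 𝓗 →L[ℂ] 𝓗) φ⟫ = d (n - m) := by
    intro m n
    have : V ^ n = V ^ m * V ^ (n - m) := by rw [← zpow_add]; congr 1; ring
    rw [this, Submonoid.coe_mul, mul_apply_eq_comp,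
      ContinuousLinearMap.inner_map_map_of_mem_unitary (V ^ m).2]
  have hneg : ∀ n : ℤ, ‖d (-n)‖ = ‖d n‖ := by
    intro n
    have h1 := hinn n 0
    rw [zero_sub] at h1
    rw [← h1, norm_inner_symm]
    simp [d]
  have hnat : Summable fun n : ℕ => ‖d (n : ℤ)‖ ^ 2 := by
    rw [← summable_nat_add_iff 1]
    refine hs.congr fun n => ?_
    simp only [d]
    rw [zpow_natCast, hVU]
  have hd : Summable fun n : ℤ => ‖d (-n)‖ ^ 2 := by
    refine Summable.of_nat_of_neg ?_ ?_
    · simpa only [hneg] using hnat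
    · simpa only [neg_neg] using hnat
  obtain ⟨f, h0, hi, hf⟩ := herglotz_density (fun n => d (-n))
    (fun j => ((V ^ (j : ℤ) : unitary (𝓗 →L[ℂ] 𝓗)) : 𝓗 →L[ℂ] 𝓗) φ)
    (fun j k => by rw [hinn, neg_sub]) hd
  refine ⟨f, h0, hi, fun n => ?_⟩
  have := hf n
  rw [neg_neg] at this
  exact this

/-- Let `U` be unitary, `A` self-adjoint, `U ∈ C¹(A)` (bounded commutator `B`),
`D = s-lim D_N` where `D_N` is the `N`-th Birkhoff average of `[A,U]U⁻¹`, with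
`∑_{N≥1} ‖(D_N − D)φ‖² < ∞` for each `φ ∈ dom A`, and `D⁻¹η(D) dom A ⊆ dom A` for
`η ∈ C_c^∞(ℝ \ {0})`.  Then each `φ ∈ dom A` with `φ = η(D)φ` for some such `η` satisfies
`∑_{N≥1} |⟪φ, U^N φ⟫|² < ∞`, and consequently `φ` lies in the absolutely continuous
subspace of `U`. -/
theorem stmt7 {𝓗 : Type*} [NormedAddCommGroup 𝓗] [InnerProductSpace ℂ 𝓗] [CompleteSpace 𝓗]
    (U : 𝓗 →L[ℂ] 𝓗) (hU : U ∈ unitary (𝓗 →L[ℂ] 𝓗))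
    (A : 𝓗 →ₗ.[ℂ] 𝓗) (hA : IsSelfAdjoint A)
    (B : 𝓗 →L[ℂ] 𝓗)
    (hB : ∀ φ : A.domain, ⟪A φ, U (φ : 𝓗)⟫ - ⟪(φ : 𝓗), U (A φ)⟫ = ⟪(φ : 𝓗), B (φ : 𝓗)⟫)
    (D : 𝓗 →L[ℂ] 𝓗) (hDsa : IsSelfAdjoint D)
    (hD : ∀ ψ : 𝓗, Tendsto
      (fun N : ℕ => ((N : ℂ)⁻¹ • ∑ n ∈ Finset.range N, U ^ n * (B * star U) * (star U) ^ n) ψ)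
      atTop (nhds (D ψ)))
    (hsum : ∀ φ : A.domain, Summable (fun N : ℕ =>
      ‖(((N + 1 : ℂ))⁻¹ • ∑ n ∈ Finset.range (N + 1),
          U ^ n * (B * star U) * (star U) ^ n) (φ : 𝓗) - D (φ : 𝓗)‖ ^ 2))
    (hdom : ∀ η : ℝ → ℝ, ContDiff ℝ (⊤ : ℕ∞) η → HasCompactSupport η → (0 : ℝ) ∉ tsupport η →
      ∀ φ : A.domain, cfc (fun x : ℝ => x⁻¹ * η x) D (φ : 𝓗) ∈ A.domain) :
    ∀ φ ∈ A.domain, ∀ η : ℝ → ℝ, ContDiff ℝ (⊤ : ℕ∞) η → HasCompactSupport η →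
      (0 : ℝ) ∉ tsupport η → φ = cfc η D φ →
      Summable (fun N : ℕ => ‖⟪φ, (U ^ (N + 1)) φ⟫‖ ^ 2) ∧ MemAbsContSubspace U hU φ := by

  intro φ hφ η hη hηc h0 he
  have hψ := hdom η hη hηc h0 ⟨φ, hφ⟩
  have hDψ : φ = D (cfc (fun x : ℝ => x⁻¹ * η x) D φ) := by
    rw [← mul_apply_eq_comp, D_cfc D hDsa η hη.continuous h0]
    exact he
  have h1 := part1 U hU A hA B hB D hsum ⟨φ, hφ⟩ ⟨_, hψ⟩ hDψ
  exact ⟨h1, part2 U hU φ h1⟩
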